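/- arXiv:1205.3235 — 2 statements merged into one kernel-verified Lean document; each statement's English description precedes it below -/
import Mathlib

section
/- Let (X,d) be a separable metric space equipped with a σ-finite Borel measure μ, and let f : X → ℝ be a Lipschitz function. Then there is a countable measurable partition X = (⊔_{i=1}^∞ A_i) ⊔ Ω such that: μ(Ω) = 0; the restrictions of Lip f and lip f to each A_i are continuous; and on each A_i, as r ↓ 0, the functions x ↦ Lip f(x,r) = sup_{0<s≤r} varlip f(x,s) converge uniformly (decreasingly) to Lip f, and the functions x ↦ lip f(x,r) = inf_{0<s≤r} varlip f(x,s) converge uniformly (increasingly) to lip f. -/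
open MeasureTheory Metric Filter Set Topology
open scoped ENNReal NNReal

noncomputable section

/-- `f` is a bounded Lipschitz function. -/
def IsBddLipschitz {X : Type*} [PseudoMetricSpace X] (f : X → ℝ) : Prop :=
  (∃ K : ℝ≥0, LipschitzWith K f) ∧ ∃ M : ℝ, ∀ x, |f x| ≤ M

/-- The global Lipschitz constant of `f`. -/
def glip {X : Type*} [PseudoMetricSpace X] (f : X → ℝ) : ℝ :=
  sInf {K : ℝ | 0 ≤ K ∧ ∀ x y, |f x - f y| ≤ K * dist x y}

/-- `max (sup_X |f|) (global Lipschitz constant of f)`. -/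
def lipNorm {X : Type*} [PseudoMetricSpace X] (f : X → ℝ) : ℝ :=
  max (⨆ x, |f x|) (glip f)

/-- The variation of `f` on the open ball `B(x,r)`:
`varlip f x r = r⁻¹ · sup_{y ∈ B(x,r)} |f x - f y|`. -/
def varlip {X : Type*} [PseudoMetricSpace X] (f : X → ℝ) (x : X) (r : ℝ) : ℝ :=
  r⁻¹ * sSup ((fun y => |f x - f y|) '' ball x r)

/-- The upper variation of `f` at `x` from scale `r` down to `0`:
`Lip f (x,r) = sup_{0 < s ≤ r} varlip f x s`. -/
def bigLipR {X : Type*} [PseudoMetricSpace X] (f : X → ℝ) (x : X) (r : ℝ) : ℝ :=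
  ⨆ s : Ioc (0:ℝ) r, varlip f x s.1

/-- The lower variation of `f` at `x` from scale `r` down to `0`:
`lip f (x,r) = inf_{0 < s ≤ r} varlip f x s`. -/
def smlLipR {X : Type*} [PseudoMetricSpace X] (f : X → ℝ) (x : X) (r : ℝ) : ℝ :=
  ⨅ s : Ioc (0:ℝ) r, varlip f x s.1

/-- The pointwise upper Lipschitz constant
`Lip f (x) = inf_{r>0} sup_{0<s≤r} varlip f x s`. -/
def bigLip {X : Type*} [PseudoMetricSpace X] (f : X → ℝ) (x : X) : ℝ :=
  ⨅ r : Ioi (0:ℝ), bigLipR f x r.1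

/-- The pointwise lower Lipschitz constant
`lip f (x) = sup_{r>0} inf_{0<s≤r} varlip f x s`. -/
def smlLip {X : Type*} [PseudoMetricSpace X] (f : X → ℝ) (x : X) : ℝ :=
  ⨆ r : Ioi (0:ℝ), smlLipR f x r.1

section Lusin

/-- **Lusin's theorem** for outer regular measures. -/
theorem exists_measurableSet_continuousOn_compl {X Y : Type*} [TopologicalSpace X]
    [MeasurableSpace X] [BorelSpace X] [TopologicalSpace Y] [SecondCountableTopology Y]
    [MeasurableSpace Y] [OpensMeasurableSpace Y] (ν : Measure X) [IsFiniteMeasure ν]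
    [ν.OuterRegular] {g : X → Y} (hg : Measurable g) {ε : ℝ≥0∞} (hε : ε ≠ 0) :
    ∃ t, MeasurableSet t ∧ ν t ≤ ε ∧ ContinuousOn g tᶜ := by
  have hB := TopologicalSpace.isBasis_countableBasis Y
  set B := TopologicalSpace.countableBasis Y
  have : Countable B := (TopologicalSpace.countable_countableBasis Y).to_subtype
  obtain ⟨δ, hδ, hsum⟩ := ENNReal.exists_pos_sum_of_countable' hε B
  have hmeas (U : B) : MeasurableSet (g ⁻¹' U) := hg (hB.isOpen U.2).measurableSet
  choose V hsub hopen _ hlt using fun U : B =>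
    (hmeas U).exists_isOpen_sdiff_lt (μ := ν) (measure_ne_top ν _) (hδ U).ne'
  refine ⟨⋃ U : B, V U \ g ⁻¹' U,
    .iUnion fun U => (hopen U).measurableSet.diff (hmeas U), ?_, ?_⟩
  · exact (measure_iUnion_le _).trans
      ((ENNReal.tsum_le_tsum fun U => (hlt U).le).trans hsum.le)
  · intro x _
    refine (hB.nhds_hasBasis (a := g x)).tendsto_right_iff.2 fun U hU => ?_
    have hx : V ⟨U, hU.1⟩ ∈ 𝓝 x := (hopen _).mem_nhds (hsub _ hU.2)
    filter_upwards [mem_nhdsWithin_of_mem_nhds hx, self_mem_nhdsWithin] with y hyV hy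
    by_contra hyU
    exact hy (mem_iUnion.2 ⟨⟨U, hU.1⟩, hyV, hyU⟩)

end Lusin

section Egorov

theorem tendsto_one_div_add_atTop_nhdsGT_zero_nat :
    Tendsto (fun n : ℕ => 1 / ((n : ℝ) + 1)) atTop (𝓝[>] 0) :=
  tendsto_nhdsWithin_iff.2 ⟨tendsto_one_div_add_atTop_nhds_zero_nat,
    .of_forall fun _ => mem_Ioi.2 Nat.one_div_pos_of_nat⟩

/-- Egorov's theorem along `r ↓ 0`, for families whose distance to the limit is monotone in `r`. -/
theorem exists_tendstoUniformlyOn_compl_of_dist_mono {X : Type*} [MeasurableSpace X]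
    (ν : Measure X) [IsFiniteMeasure ν] {F : ℝ → X → ℝ} {G : X → ℝ}
    (hF : ∀ r, 0 < r → Measurable (F r)) (hG : Measurable G)
    (hlim : ∀ x, Tendsto (fun r => F r x) (𝓝[>] 0) (𝓝 (G x)))
    (hmono : ∀ x r s, 0 < r → r ≤ s → dist (G x) (F r x) ≤ dist (G x) (F s x))
    {ε : ℝ≥0∞} (hε : ε ≠ 0) :
    ∃ t, MeasurableSet t ∧ ν t ≤ ε ∧ TendstoUniformlyOn F G (𝓝[>] 0) tᶜ := by
  obtain ⟨δ, hδ, hδε⟩ := ENNReal.lt_iff_exists_nnreal_btwn.1 (pos_iff_ne_zero.2 hε)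
  obtain ⟨t, ht, hνt, hunif⟩ := tendstoUniformlyOn_of_ae_tendsto' (μ := ν)
    (f := fun (n : ℕ) => F (1 / ((n : ℝ) + 1))) (g := G)
    (fun n => (hF _ Nat.one_div_pos_of_nat).stronglyMeasurable) hG.stronglyMeasurable
    (.of_forall fun x => (hlim x).comp tendsto_one_div_add_atTop_nhdsGT_zero_nat) (ε := δ) (by exact_mod_cast hδ)
  refine ⟨t, ht, hνt.trans (by simpa using hδε.le), ?_⟩
  rw [Metric.tendstoUniformlyOn_iff] at hunif ⊢
  intro η hη
  obtain ⟨n, hn⟩ := (hunif η hη).exists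
  filter_upwards [Ioc_mem_nhdsGT (Nat.one_div_pos_of_nat (n := n) (α := ℝ))] with r hr x hx
  exact (hmono x r _ hr.1 hr.2).trans_lt (hn x hx)

/-- A hereditary property holding off sets of arbitrarily small measure holds on each piece of
a countable measurable partition of a set of full measure. -/
theorem exists_partition_of_forall_small_compl {X : Type*} [MeasurableSpace X] (ν : Measure X)
    {P : Set X → Prop} (hP : ∀ s t, s ⊆ t → P t → P s)
    (h : ∀ ε : ℝ≥0∞, ε ≠ 0 → ∃ t, MeasurableSet t ∧ ν t ≤ ε ∧ P tᶜ) :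
    ∃ (A : ℕ → Set X) (Ω : Set X), (∀ i, MeasurableSet (A i)) ∧ MeasurableSet Ω ∧
      Pairwise (Function.onFun Disjoint A) ∧ (∀ i, Disjoint (A i) Ω) ∧
      ((⋃ i, A i) ∪ Ω = univ) ∧ ν Ω = 0 ∧ ∀ i, P (A i) := by
  choose t ht hνt hPt using fun k : ℕ => h ((k : ℝ≥0∞)⁻¹) (by simp)
  have hA (i) : MeasurableSet (disjointed (fun k => (t k)ᶜ) i) :=
    MeasurableSet.disjointed (fun k => (ht k).compl) i
  refine ⟨disjointed fun k => (t k)ᶜ, (⋃ i, disjointed (fun k => (t k)ᶜ) i)ᶜ, hA,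
    (MeasurableSet.iUnion hA).compl, disjoint_disjointed _,
    fun i => disjoint_compl_right.mono_left (subset_iUnion _ i), union_compl_self _, ?_,
    fun i => hP _ _ (disjointed_subset _ i) (hPt i)⟩
  rw [iUnion_disjointed, compl_iUnion]
  simp only [compl_compl]
  refine le_antisymm (ge_of_tendsto' ENNReal.tendsto_inv_nat_nhds_zero fun k => ?_) zero_le
  exact (measure_mono (iInter_subset t k)).trans (hνt k)

end Egorov

section Varlip

variable {X : Type*} [PseudoMetricSpace X] {f : X → ℝ} {K : ℝ≥0}

theorem LipschitzWith.abs_sub_le_of_mem_ball (hf : LipschitzWith K f) {x y : X} {r : ℝ}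
    (hy : y ∈ ball x r) : |f x - f y| ≤ K * r := by
  rw [← Real.dist_eq]
  exact (hf.dist_le_mul x y).trans
    (mul_le_mul_of_nonneg_left (mem_ball'.1 hy).le K.coe_nonneg)

theorem LipschitzWith.bddAbove_image_ball (hf : LipschitzWith K f) (x : X) (r : ℝ) :
    BddAbove ((fun y => |f x - f y|) '' ball x r) :=
  ⟨K * r, forall_mem_image.2 fun _ hy => hf.abs_sub_le_of_mem_ball hy⟩

theorem varlip_nonneg (f : X → ℝ) (x : X) {r : ℝ} (hr : 0 < r) : 0 ≤ varlip f x r :=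
  mul_nonneg (inv_nonneg.2 hr.le) (Real.sSup_nonneg (forall_mem_image.2 fun _ _ => abs_nonneg _))

theorem LipschitzWith.varlip_le (hf : LipschitzWith K f) (x : X) {r : ℝ} (hr : 0 < r) :
    varlip f x r ≤ K := by
  rw [varlip, inv_mul_le_iff₀ hr, mul_comm]
  exact csSup_le ((nonempty_ball.2 hr).image _)
    (forall_mem_image.2 fun _ hy => hf.abs_sub_le_of_mem_ball hy)

theorem LipschitzWith.varlip_le_div_mul (hf : LipschitzWith K f) (x : X) {q s : ℝ} (hq : 0 < q)
    (hqs : q ≤ s) : varlip f x q ≤ s / q * varlip f x s := by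
  have hs : s ≠ 0 := (hq.trans_le hqs).ne'
  have : s / q * varlip f x s = q⁻¹ * sSup ((fun y => |f x - f y|) '' ball x s) := by
    rw [varlip]; field_simp
  rw [this, varlip]
  exact mul_le_mul_of_nonneg_left
    (csSup_le_csSup (hf.bddAbove_image_ball x s) ((nonempty_ball.2 hq).image _)
      (image_mono (ball_subset_ball hqs))) (inv_nonneg.2 hq.le)

theorem LipschitzWith.lowerSemicontinuous_varlip (hf : LipschitzWith K f) {r : ℝ} (hr : 0 < r) :
    LowerSemicontinuous fun x => varlip f x r := by
  intro x c hc
  simp only [varlip, gt_iff_lt, lt_inv_mul_iff₀ hr] at hc ⊢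
  obtain ⟨_, ⟨y, hy, rfl⟩, hlt⟩ := exists_lt_of_lt_csSup ((nonempty_ball.2 hr).image _) hc
  have hcont : Continuous fun x' => |f x' - f y| := (hf.continuous.sub continuous_const).abs
  filter_upwards [hcont.continuousAt.eventually (lt_mem_nhds hlt),
    isOpen_ball.mem_nhds (mem_ball_comm.1 hy)] with x' hx' hball
  exact hx'.trans_le (le_csSup (hf.bddAbove_image_ball x' r) ⟨y, mem_ball_comm.1 hball, rfl⟩)

theorem LipschitzWith.bddAbove_range_varlip (hf : LipschitzWith K f) (x : X) (r : ℝ) :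
    BddAbove (range fun s : Ioc (0 : ℝ) r => varlip f x s) :=
  ⟨K, forall_mem_range.2 fun s => hf.varlip_le x s.2.1⟩

theorem bddBelow_range_varlip (f : X → ℝ) (x : X) (r : ℝ) :
    BddBelow (range fun s : Ioc (0 : ℝ) r => varlip f x s) :=
  ⟨0, forall_mem_range.2 fun s => varlip_nonneg f x s.2.1⟩

theorem LipschitzWith.bigLipR_mono (hf : LipschitzWith K f) (x : X) {r s : ℝ} (hr : 0 < r)
    (hrs : r ≤ s) : bigLipR f x r ≤ bigLipR f x s := by
  have : Nonempty (Ioc (0 : ℝ) r) := ⟨⟨r, hr, le_rfl⟩⟩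
  exact ciSup_le fun u => le_ciSup (hf.bddAbove_range_varlip x s) ⟨u, u.2.1, u.2.2.trans hrs⟩

theorem smlLipR_anti (f : X → ℝ) (x : X) {r s : ℝ} (hr : 0 < r) (hrs : r ≤ s) :
    smlLipR f x s ≤ smlLipR f x r := by
  have : Nonempty (Ioc (0 : ℝ) r) := ⟨⟨r, hr, le_rfl⟩⟩
  exact le_ciInf fun u => ciInf_le (bddBelow_range_varlip f x s) ⟨u, u.2.1, u.2.2.trans hrs⟩

theorem bddBelow_range_bigLipR (f : X → ℝ) (x : X) :
    BddBelow (range fun r : Ioi (0 : ℝ) => bigLipR f x r) :=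
  ⟨0, forall_mem_range.2 fun _ => Real.iSup_nonneg fun s => varlip_nonneg f x s.2.1⟩

theorem LipschitzWith.bddAbove_range_smlLipR (hf : LipschitzWith K f) (x : X) :
    BddAbove (range fun r : Ioi (0 : ℝ) => smlLipR f x r) :=
  ⟨K, forall_mem_range.2 fun r => (ciInf_le (bddBelow_range_varlip f x r)
    ⟨r, r.2, le_rfl⟩).trans (hf.varlip_le x r.2)⟩

theorem bigLip_le_bigLipR (f : X → ℝ) (x : X) {r : ℝ} (hr : 0 < r) :
    bigLip f x ≤ bigLipR f x r :=
  ciInf_le (bddBelow_range_bigLipR f x) ⟨r, hr⟩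

theorem LipschitzWith.smlLipR_le_smlLip (hf : LipschitzWith K f) (x : X) {r : ℝ} (hr : 0 < r) :
    smlLipR f x r ≤ smlLip f x :=
  le_ciSup (hf.bddAbove_range_smlLipR x) ⟨r, hr⟩

theorem LipschitzWith.tendsto_bigLipR (hf : LipschitzWith K f) (x : X) :
    Tendsto (fun r => bigLipR f x r) (𝓝[>] 0) (𝓝 (bigLip f x)) := by
  refine tendsto_order.2 ⟨fun c hc => ?_, fun c hc => ?_⟩
  · filter_upwards [self_mem_nhdsWithin] with r hr using hc.trans_le (bigLip_le_bigLipR f x hr)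
  · obtain ⟨⟨s, hs⟩, hlt⟩ := exists_lt_of_ciInf_lt hc
    filter_upwards [Ioc_mem_nhdsGT hs] with r hr using (hf.bigLipR_mono x hr.1 hr.2).trans_lt hlt

theorem LipschitzWith.tendsto_smlLipR (hf : LipschitzWith K f) (x : X) :
    Tendsto (fun r => smlLipR f x r) (𝓝[>] 0) (𝓝 (smlLip f x)) := by
  refine tendsto_order.2 ⟨fun c hc => ?_, fun c hc => ?_⟩
  · obtain ⟨⟨s, hs⟩, hlt⟩ := exists_lt_of_lt_ciSup hc
    filter_upwards [Ioc_mem_nhdsGT hs] with r hr using hlt.trans_le (smlLipR_anti f x hr.1 hr.2)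
  · filter_upwards [self_mem_nhdsWithin] with r hr using (hf.smlLipR_le_smlLip x hr).trans_lt hc

/-- The infimum defining `smlLipR` may be taken over rational scales only. -/
theorem LipschitzWith.smlLipR_eq_iInf_rat (hf : LipschitzWith K f) (x : X) {r : ℝ} (hr : 0 < r) :
    smlLipR f x r = ⨅ q : {q : ℚ // 0 < (q : ℝ) ∧ (q : ℝ) < r}, varlip f x q := by
  have : Nonempty (Ioc (0 : ℝ) r) := ⟨⟨r, hr, le_rfl⟩⟩
  have : Nonempty {q : ℚ // 0 < (q : ℝ) ∧ (q : ℝ) < r} :=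
    (exists_rat_btwn hr).elim fun q hq => ⟨⟨q, hq⟩⟩
  have hbdd : BddBelow (range fun q : {q : ℚ // 0 < (q : ℝ) ∧ (q : ℝ) < r} => varlip f x q) :=
    ⟨0, forall_mem_range.2 fun q => varlip_nonneg f x q.2.1⟩
  refine le_antisymm (le_ciInf fun q => ciInf_le (bddBelow_range_varlip f x r)
    ⟨q, q.2.1, q.2.2.le⟩) (le_ciInf fun ⟨s, hs⟩ => ?_)
  have hcont : ContinuousAt (fun q : ℝ => s / q * varlip f x s) s :=
    (continuousAt_const.div continuousAt_id hs.1.ne').mul continuousAt_const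
  have hlim : Tendsto (fun q : ℝ => s / q * varlip f x s) (𝓝[<] s) (𝓝 (varlip f x s)) := by
    simpa [ContinuousAt, div_self hs.1.ne'] using hcont.mono_left nhdsWithin_le_nhds
  refine le_of_forall_gt fun c hc => ?_
  obtain ⟨a, ha, hac⟩ := (mem_nhdsLT_iff_exists_Ioo_subset' hs.1).1
    (hlim.eventually (gt_mem_nhds hc))
  obtain ⟨q, hq, hqs⟩ := exists_rat_btwn (max_lt ha hs.1)
  have hq0 : 0 < (q : ℝ) := (le_max_right _ _).trans_lt hq
  exact (ciInf_le hbdd ⟨q, hq0, hqs.trans_le hs.2⟩).trans_lt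
    ((hf.varlip_le_div_mul x hq0 hqs.le).trans_lt
      (hac ⟨(le_max_left _ _).trans_lt hq, hqs⟩))

variable [MeasurableSpace X] [OpensMeasurableSpace X]

theorem LipschitzWith.measurable_bigLipR (hf : LipschitzWith K f) (r : ℝ) :
    Measurable fun x => bigLipR f x r :=
  (lowerSemicontinuous_ciSup (fun x => hf.bddAbove_range_varlip x r)
    fun s => hf.lowerSemicontinuous_varlip s.2.1).measurable

theorem LipschitzWith.measurable_smlLipR (hf : LipschitzWith K f) {r : ℝ} (hr : 0 < r) :
    Measurable fun x => smlLipR f x r := by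
  simp only [hf.smlLipR_eq_iInf_rat _ hr]
  exact .iInf fun q => (hf.lowerSemicontinuous_varlip q.2.1).measurable

theorem LipschitzWith.measurable_bigLip (hf : LipschitzWith K f) : Measurable (bigLip f) :=
  measurable_of_tendsto_metrizable' atTop (fun n : ℕ => hf.measurable_bigLipR (1 / ((n : ℝ) + 1)))
    (tendsto_pi_nhds.2 fun x => (hf.tendsto_bigLipR x).comp
      tendsto_one_div_add_atTop_nhdsGT_zero_nat)

theorem LipschitzWith.measurable_smlLip (hf : LipschitzWith K f) : Measurable (smlLip f) :=
  measurable_of_tendsto_metrizable' atTop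
    (fun n : ℕ => hf.measurable_smlLipR (Nat.one_div_pos_of_nat (n := n)))
    (tendsto_pi_nhds.2 fun x => (hf.tendsto_smlLipR x).comp
      tendsto_one_div_add_atTop_nhdsGT_zero_nat)

end Varlip

theorem stmt_3 {X : Type*} [MetricSpace X] [TopologicalSpace.SeparableSpace X]
    [MeasurableSpace X] [BorelSpace X] (μ : Measure X) [SigmaFinite μ]
    (f : X → ℝ) {K : ℝ≥0} (hf : LipschitzWith K f) :
    ∃ (A : ℕ → Set X) (Ω : Set X),
      (∀ i, MeasurableSet (A i)) ∧ MeasurableSet Ω ∧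
      Pairwise (Function.onFun Disjoint A) ∧ (∀ i, Disjoint (A i) Ω) ∧
      ((⋃ i, A i) ∪ Ω = univ) ∧ μ Ω = 0 ∧
      (∀ i, ContinuousOn (bigLip f) (A i)) ∧
      (∀ i, ContinuousOn (smlLip f) (A i)) ∧
      (∀ x : X, ∀ r s : ℝ, 0 < r → r ≤ s → bigLipR f x r ≤ bigLipR f x s) ∧
      (∀ x : X, ∀ r s : ℝ, 0 < r → r ≤ s → smlLipR f x s ≤ smlLipR f x r) ∧
      (∀ i, TendstoUniformlyOn (fun r x => bigLipR f x r) (bigLip f) (𝓝[>] (0:ℝ)) (A i)) ∧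
      (∀ i, TendstoUniformlyOn (fun r x => smlLipR f x r) (smlLip f) (𝓝[>] (0:ℝ)) (A i)) := by
  obtain ⟨ν, hν, hμν, -⟩ := exists_isFiniteMeasure_absolutelyContinuous μ
  obtain ⟨A, Ω, hA, hΩ, hdisj, hAΩ, hcover, hνΩ, hprop⟩ :=
    exists_partition_of_forall_small_compl ν
      (P := fun s => ContinuousOn (bigLip f) s ∧ ContinuousOn (smlLip f) s ∧
        TendstoUniformlyOn (fun r x => bigLipR f x r) (bigLip f) (𝓝[>] (0:ℝ)) s ∧
        TendstoUniformlyOn (fun r x => smlLipR f x r) (smlLip f) (𝓝[>] (0:ℝ)) s)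
      (fun s t hst h => ⟨h.1.mono hst, h.2.1.mono hst, h.2.2.1.mono hst, h.2.2.2.mono hst⟩)
      (fun ε hε => by
        have hε4 : ε / 4 ≠ 0 := by simp [ENNReal.div_eq_zero_iff, hε]
        obtain ⟨t₁, ht₁, hν₁, h₁⟩ :=
          exists_measurableSet_continuousOn_compl ν hf.measurable_bigLip hε4
        obtain ⟨t₂, ht₂, hν₂, h₂⟩ :=
          exists_measurableSet_continuousOn_compl ν hf.measurable_smlLip hε4
        obtain ⟨t₃, ht₃, hν₃, h₃⟩ := exists_tendstoUniformlyOn_compl_of_dist_mono ν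
          (fun r _ => hf.measurable_bigLipR r) hf.measurable_bigLip hf.tendsto_bigLipR
          (fun x r s hr hrs => by
            have h := bigLip_le_bigLipR f x hr
            have h' := hf.bigLipR_mono x hr hrs
            rw [Real.dist_eq, Real.dist_eq, abs_of_nonpos (by linarith),
              abs_of_nonpos (by linarith)]
            linarith) hε4
        obtain ⟨t₄, ht₄, hν₄, h₄⟩ := exists_tendstoUniformlyOn_compl_of_dist_mono ν
          (fun r hr => hf.measurable_smlLipR hr) hf.measurable_smlLip hf.tendsto_smlLipR
          (fun x r s hr hrs => by
            have h := hf.smlLipR_le_smlLip x hr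
            have h' := smlLipR_anti f x hr hrs
            rw [Real.dist_eq, Real.dist_eq, abs_of_nonneg (by linarith),
              abs_of_nonneg (by linarith)]
            linarith) hε4
        refine ⟨t₁ ∪ t₂ ∪ (t₃ ∪ t₄), (ht₁.union ht₂).union (ht₃.union ht₄), ?_,
          h₁.mono (compl_subset_compl.2 fun x hx => .inl (.inl hx)),
          h₂.mono (compl_subset_compl.2 fun x hx => .inl (.inr hx)),
          h₃.mono (compl_subset_compl.2 fun x hx => .inr (.inl hx)),
          h₄.mono (compl_subset_compl.2 fun x hx => .inr (.inr hx))⟩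
        calc ν (t₁ ∪ t₂ ∪ (t₃ ∪ t₄))
            ≤ (ν t₁ + ν t₂) + (ν t₃ + ν t₄) := (measure_union_le _ _).trans
              (add_le_add (measure_union_le _ _) (measure_union_le _ _))
          _ ≤ (ε / 4 + ε / 4) + (ε / 4 + ε / 4) := by gcongr
          _ = 4 * (ε / 4) := by ring
          _ = ε := ENNReal.mul_div_cancel (by norm_num) (by norm_num))
  exact ⟨A, Ω, hA, hΩ, hdisj, hAΩ, hcover, hμν hνΩ, fun i => (hprop i).1, fun i => (hprop i).2.1,
    fun x r s hr hrs => hf.bigLipR_mono x hr hrs, fun x r s hr hrs => smlLipR_anti f x hr hrs,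
    fun i => (hprop i).2.2.1, fun i => (hprop i).2.2.2⟩
end
end

section
/- Let (X,d,μ) be a metric space with a σ-finite Borel measure, let D_1,…,D_n be derivations on (X,d,μ) that are linearly independent over L∞(μ), and let G = {g_1,…,g_M} be a finite set of bounded Lipschitz functions that sequentially generates the bounded Lipschitz functions on X. Then there exist: a subset {g'_1,…,g'_n} ⊆ G; a measurable set V ⊆ X with μ(V) > 0; and measurable μ-essentially bounded functions a_{ij} : V → ℝ (1 ≤ i,j ≤ n) such that the matrix (a_{ij}(x)) is invertible for μ-a.e. x ∈ V, and the derivations D'_i := Σ_{j=1}^n a_{ij}·D_j (restricted to V) satisfy D'_i g'_j(x) = δ_{ij} for μ-a.e. x ∈ V and all i,j = 1,…,n. -/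
open MeasureTheory Metric Filter Set Topology
open scoped ENNReal NNReal

noncomputable section

/-- A derivation on the metric measure space `(X,d,μ)`: a linear, bounded operator
from bounded Lipschitz functions to measurable essentially bounded functions that
satisfies the Leibniz rule and is weak* sequentially continuous. -/
structure MDerivation (X : Type*) [PseudoMetricSpace X] [MeasurableSpace X]
    (μ : MeasureTheory.Measure X) where
  D : (X → ℝ) → (X → ℝ)
  C : ℝ
  C_nonneg : 0 ≤ C
  measurable_D : ∀ f, IsBddLipschitz f → Measurable (D f)
  linear : ∀ (a b : ℝ) (f g : X → ℝ), IsBddLipschitz f → IsBddLipschitz g →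
      ∀ᵐ x ∂μ, D (fun y => a * f y + b * g y) x = a * D f x + b * D g x
  bound : ∀ f, IsBddLipschitz f → ∀ᵐ x ∂μ, |D f x| ≤ C * lipNorm f
  leibniz : ∀ f g, IsBddLipschitz f → IsBddLipschitz g →
      ∀ᵐ x ∂μ, D (fun y => f y * g y) x = f x * D g x + g x * D f x
  weakStar : ∀ (F : ℕ → X → ℝ) (f : X → ℝ), (∀ n, IsBddLipschitz (F n)) →
      IsBddLipschitz f → (∃ B : ℝ, ∀ n, lipNorm (F n) ≤ B) →
      (∀ x, Tendsto (fun n => F n x) atTop (𝓝 (f x))) →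
      ∀ g : X → ℝ, Integrable g μ →
        Tendsto (fun n => ∫ x, D (F n) x * g x ∂μ) atTop (𝓝 (∫ x, D f x * g x ∂μ))

/-- The derivations `D_1,…,D_n` are linearly independent over `L∞(μ)`. -/
def LinIndepDer {X : Type*} [PseudoMetricSpace X] [MeasurableSpace X]
    (μ : MeasureTheory.Measure X) {n : ℕ} (Ds : Fin n → MDerivation X μ) : Prop :=
  ∀ lam : Fin n → X → ℝ, (∀ i, Measurable (lam i)) →
    (∀ i, ∃ M : ℝ, ∀ᵐ x ∂μ, |lam i x| ≤ M) →
    (∀ f, IsBddLipschitz f → ∀ᵐ x ∂μ, (∑ i, lam i x * (Ds i).D f x) = 0) →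
    ∀ i, ∀ᵐ x ∂μ, lam i x = 0

/-- `G` sequentially generates the bounded Lipschitz functions: every bounded
Lipschitz function is the pointwise limit of a sequence, with uniformly bounded
Lipschitz norms, from the unital `ℝ`-subalgebra generated by `G`. -/
def SeqGenerates {X : Type*} [PseudoMetricSpace X] (G : Set (X → ℝ)) : Prop :=
  ∀ f : X → ℝ, IsBddLipschitz f → ∃ p : ℕ → X → ℝ,
    (∀ k, p k ∈ Algebra.adjoin ℝ G) ∧ (∃ B : ℝ, ∀ k, lipNorm (p k) ≤ B) ∧
    ∀ x, Tendsto (fun k => p k x) atTop (𝓝 (f x))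

theorem IsBddLipschitz.const {X : Type*} [PseudoMetricSpace X] (c : ℝ) :
    IsBddLipschitz (fun _ : X => c) :=
  ⟨⟨0, LipschitzWith.const c⟩, |c|, fun _ => le_rfl⟩

theorem IsBddLipschitz.add {X : Type*} [PseudoMetricSpace X] {f g : X → ℝ}
    (hf : IsBddLipschitz f) (hg : IsBddLipschitz g) :
    IsBddLipschitz (fun x => f x + g x) := by
  obtain ⟨⟨K, hK⟩, A, hA⟩ := hf
  obtain ⟨⟨L, hL⟩, B, hB⟩ := hg
  exact ⟨⟨K + L, hK.add hL⟩, A + B,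
    fun x => (abs_add_le _ _).trans (add_le_add (hA x) (hB x))⟩

theorem IsBddLipschitz.mul {X : Type*} [PseudoMetricSpace X] {f g : X → ℝ}
    (hf : IsBddLipschitz f) (hg : IsBddLipschitz g) :
    IsBddLipschitz (fun x => f x * g x) := by
  obtain ⟨⟨K, hK⟩, A, hA⟩ := hf
  obtain ⟨⟨L, hL⟩, B, hB⟩ := hg
  refine ⟨⟨A.toNNReal * L + B.toNNReal * K, LipschitzWith.of_dist_le_mul fun x y => ?_⟩,
    A * B, fun x => ?_⟩
  · have hA0 : 0 ≤ A := (abs_nonneg _).trans (hA x)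
    have hB0 : 0 ≤ B := (abs_nonneg _).trans (hB x)
    have h1 := hK.dist_le_mul x y
    have h2 := hL.dist_le_mul x y
    rw [Real.dist_eq] at h1 h2 ⊢
    push_cast
    rw [Real.coe_toNNReal _ hA0, Real.coe_toNNReal _ hB0]
    calc |f x * g x - f y * g y| = |f x * (g x - g y) + g y * (f x - f y)| := by ring_nf
      _ ≤ |f x * (g x - g y)| + |g y * (f x - f y)| := abs_add_le _ _
      _ = |f x| * |g x - g y| + |g y| * |f x - f y| := by rw [abs_mul, abs_mul]
      _ ≤ A * (L * dist x y) + B * (K * dist x y) := by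
          gcongr
          · exact hA x
          · exact hB y
      _ = _ := by ring
  · rw [abs_mul]
    exact mul_le_mul (hA x) (hB x) (abs_nonneg _) ((abs_nonneg _).trans (hA x))

theorem IsBddLipschitz.of_mem_adjoin {X : Type*} [PseudoMetricSpace X] {G : Set (X → ℝ)}
    (hG : ∀ f ∈ G, IsBddLipschitz f) {p : X → ℝ} (hp : p ∈ Algebra.adjoin ℝ G) :
    IsBddLipschitz p := by
  induction hp using Algebra.adjoin_induction with
  | mem f hf => exact hG f hf
  | algebraMap c => exact IsBddLipschitz.const c
  | add f g _ _ hf hg => exact hf.add hg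
  | mul f g _ _ hf hg => exact hf.mul hg

/-- Measurable functions that are essentially bounded with respect to `μ`. -/
def MeasEssBdd {X : Type*} [MeasurableSpace X] (μ : Measure X) (f : X → ℝ) : Prop :=
  Measurable f ∧ ∃ M : ℝ, ∀ᵐ x ∂μ, |f x| ≤ M

namespace MeasEssBdd

variable {X : Type*} [MeasurableSpace X] {μ : Measure X}

theorem const (c : ℝ) : MeasEssBdd μ (fun _ => c) :=
  ⟨measurable_const, |c|, ae_of_all _ fun _ => le_rfl⟩

theorem add {f g : X → ℝ} (hf : MeasEssBdd μ f) (hg : MeasEssBdd μ g) :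
    MeasEssBdd μ (fun x => f x + g x) := by
  obtain ⟨hfm, A, hA⟩ := hf
  obtain ⟨hgm, B, hB⟩ := hg
  refine ⟨hfm.add hgm, A + B, ?_⟩
  filter_upwards [hA, hB] with x h1 h2
  exact (abs_add_le _ _).trans (add_le_add h1 h2)

theorem mul {f g : X → ℝ} (hf : MeasEssBdd μ f) (hg : MeasEssBdd μ g) :
    MeasEssBdd μ (fun x => f x * g x) := by
  obtain ⟨hfm, A, hA⟩ := hf
  obtain ⟨hgm, B, hB⟩ := hg
  refine ⟨hfm.mul hgm, A * B, ?_⟩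
  filter_upwards [hA, hB] with x h1 h2
  rw [abs_mul]
  exact mul_le_mul h1 h2 (abs_nonneg _) ((abs_nonneg _).trans h1)

theorem sum {ι : Type*} (s : Finset ι) {f : ι → X → ℝ} (hf : ∀ i, MeasEssBdd μ (f i)) :
    MeasEssBdd μ (fun x => ∑ i ∈ s, f i x) := by
  classical
  induction s using Finset.induction_on with
  | empty => simpa using const 0
  | insert i s hi ih => simpa [Finset.sum_insert hi] using (hf i).add ih

theorem prod {ι : Type*} (s : Finset ι) {f : ι → X → ℝ} (hf : ∀ i, MeasEssBdd μ (f i)) :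
    MeasEssBdd μ (fun x => ∏ i ∈ s, f i x) := by
  classical
  induction s using Finset.induction_on with
  | empty => simpa using const 1
  | insert i s hi ih => simpa [Finset.prod_insert hi] using (hf i).mul ih

theorem det {ι : Type*} [Fintype ι] [DecidableEq ι] {A : X → Matrix ι ι ℝ}
    (hA : ∀ i j, MeasEssBdd μ (fun x => A x i j)) : MeasEssBdd μ (fun x => (A x).det) := by
  simp only [Matrix.det_apply']
  exact sum _ fun τ => (const _).mul (prod _ fun i => hA (τ i) i)

theorem adjugate {ι : Type*} [Fintype ι] [DecidableEq ι] {A : X → Matrix ι ι ℝ}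
    (hA : ∀ i j, MeasEssBdd μ (fun x => A x i j)) (i j : ι) :
    MeasEssBdd μ (fun x => (A x).adjugate i j) := by
  simp only [Matrix.adjugate_apply]
  refine det fun k l => ?_
  simp only [Matrix.updateRow_apply]
  split_ifs
  · exact const _
  · exact hA k l

end MeasEssBdd

namespace MDerivation

variable {X : Type*} [PseudoMetricSpace X] [MeasurableSpace X] {μ : Measure X}

theorem measEssBdd (D : MDerivation X μ) {f : X → ℝ} (hf : IsBddLipschitz f) :
    MeasEssBdd μ (D.D f) :=
  ⟨D.measurable_D f hf, _, D.bound f hf⟩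

theorem D_const (D : MDerivation X μ) (c : ℝ) : ∀ᵐ x ∂μ, D.D (fun _ => c) x = 0 := by
  have h1 := D.leibniz _ _ (IsBddLipschitz.const 1) (IsBddLipschitz.const 1)
  have hc := D.linear c 0 _ _ (IsBddLipschitz.const 1) (IsBddLipschitz.const 1)
  simp only [mul_one, one_mul, zero_mul, add_zero] at h1 hc
  filter_upwards [h1, hc] with x h1 hc
  rw [hc, show D.D (fun _ => 1) x = 0 by linarith, mul_zero]

theorem sum_mul_D_eq_zero_of_mem_adjoin {n : ℕ} (Ds : Fin n → MDerivation X μ)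
    (lam : Fin n → X → ℝ) {G : Set (X → ℝ)} (hG : ∀ f ∈ G, IsBddLipschitz f)
    (h0 : ∀ f ∈ G, ∀ᵐ x ∂μ, ∑ i, lam i x * (Ds i).D f x = 0)
    {p : X → ℝ} (hp : p ∈ Algebra.adjoin ℝ G) :
    ∀ᵐ x ∂μ, ∑ i, lam i x * (Ds i).D p x = 0 := by
  induction hp using Algebra.adjoin_induction with
  | mem f hf => exact h0 f hf
  | algebraMap c =>
    filter_upwards [ae_all_iff.2 fun i => (Ds i).D_const c] with x hx
    refine Finset.sum_eq_zero fun i _ => ?_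
    rw [show (algebraMap ℝ (X → ℝ)) c = fun _ => c from rfl, hx i, mul_zero]
  | add f g hf hg ihf ihg =>
    have hlin := ae_all_iff.2 fun i => (Ds i).linear 1 1 f g
      (IsBddLipschitz.of_mem_adjoin hG hf) (IsBddLipschitz.of_mem_adjoin hG hg)
    simp only [one_mul] at hlin
    filter_upwards [hlin, ihf, ihg] with x hx h1 h2
    rw [show f + g = fun y => f y + g y from rfl]
    simp only [hx, mul_add, Finset.sum_add_distrib, h1, h2, add_zero]
  | mul f g hf hg ihf ihg =>
    have hlei := ae_all_iff.2 fun i => (Ds i).leibniz f g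
      (IsBddLipschitz.of_mem_adjoin hG hf) (IsBddLipschitz.of_mem_adjoin hG hg)
    filter_upwards [hlei, ihf, ihg] with x hx h1 h2
    rw [show f * g = fun y => f y * g y from rfl]
    simp only [hx, mul_add, Finset.sum_add_distrib, mul_left_comm (lam _ x),
      ← Finset.mul_sum, h1, h2, mul_zero, add_zero]

/-- An `L∞`-combination of derivations vanishing on a sequentially generating set vanishes. -/
theorem sum_mul_D_eq_zero_of_seqGenerates [SigmaFinite μ] {n : ℕ}
    (Ds : Fin n → MDerivation X μ) {lam : Fin n → X → ℝ} (hlam : ∀ i, MeasEssBdd μ (lam i))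
    {G : Set (X → ℝ)} (hG : ∀ f ∈ G, IsBddLipschitz f) (hgen : SeqGenerates G)
    (h0 : ∀ f ∈ G, ∀ᵐ x ∂μ, ∑ i, lam i x * (Ds i).D f x = 0)
    {f : X → ℝ} (hf : IsBddLipschitz f) :
    ∀ᵐ x ∂μ, ∑ i, lam i x * (Ds i).D f x = 0 := by
  obtain ⟨p, hpG, hpB, hpf⟩ := hgen f hf
  have hp : ∀ k, IsBddLipschitz (p k) := fun k => IsBddLipschitz.of_mem_adjoin hG (hpG k)
  have hIntegrable : ∀ {u : X → ℝ}, MeasEssBdd μ u → ∀ s, μ s < ∞ → IntegrableOn u s μ := by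
    rintro u ⟨hu, B, hB⟩ s hs
    exact Measure.integrableOn_of_bounded hs.ne hu.aestronglyMeasurable
      (ae_restrict_of_ae hB)
  have hsum : ∀ u, IsBddLipschitz u → ∀ s, MeasurableSet s → μ s < ∞ →
      ∫ x in s, ∑ i, lam i x * (Ds i).D u x ∂μ
        = ∑ i, ∫ x, (Ds i).D u x * s.indicator (lam i) x ∂μ := by
    intro u hu s hs hμs
    rw [integral_finsetSum _ fun i _ => hIntegrable ((hlam i).mul ((Ds i).measEssBdd hu)) s hμs]
    refine Finset.sum_congr rfl fun i _ => ?_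
    rw [← integral_indicator hs]
    refine integral_congr_ae (ae_of_all _ fun x => ?_)
    by_cases hx : x ∈ s <;> simp [hx, mul_comm]
  refine ae_eq_zero_of_forall_setIntegral_eq_of_sigmaFinite
    (fun s _ hμs => hIntegrable (MeasEssBdd.sum _ fun i => (hlam i).mul ((Ds i).measEssBdd hf)) s hμs)
    fun s hs hμs => ?_
  have hlim : Tendsto (fun k => ∑ i, ∫ x, (Ds i).D (p k) x * s.indicator (lam i) x ∂μ) atTop
      (𝓝 (∑ i, ∫ x, (Ds i).D f x * s.indicator (lam i) x ∂μ)) :=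
    tendsto_finsetSum _ fun i _ => (Ds i).weakStar p f hp hf hpB hpf _
      ((integrable_indicator_iff hs).2 (hIntegrable (hlam i) s hμs))
  have hzero : ∀ k, ∑ i, ∫ x, (Ds i).D (p k) x * s.indicator (lam i) x ∂μ = 0 := by
    intro k
    rw [← hsum _ (hp k) s hs hμs]
    exact integral_eq_zero_of_ae
      (ae_restrict_of_ae (sum_mul_D_eq_zero_of_mem_adjoin Ds lam hG h0 (hpG k)))
  simp only [hzero] at hlim
  rw [hsum f hf s hs hμs]
  exact tendsto_nhds_unique hlim tendsto_const_nhds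

end MDerivation

/-- The coefficients of the cofactor expansion of `A.submatrix (Fin.cons j s) (Fin.cons c t)`
along its first row, collected by columns of `A`; they do not depend on `j`. -/
def cofactorCoeff {M n r : ℕ} (A : Matrix (Fin M) (Fin n) ℝ) (s : Fin r → Fin M)
    (t : Fin r → Fin n) (c k : Fin n) : ℝ :=
  ∑ i : Fin (r + 1), (if (Fin.cons c t : Fin (r + 1) → Fin n) i = k then (-1) ^ (i : ℕ) else 0) *
    (A.submatrix s fun l => (Fin.cons c t : Fin (r + 1) → Fin n) (i.succAbove l)).det

theorem sum_cofactorCoeff_mul {M n r : ℕ} (A : Matrix (Fin M) (Fin n) ℝ) (s : Fin r → Fin M)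
    (t : Fin r → Fin n) (c : Fin n) (j : Fin M) :
    ∑ k, cofactorCoeff A s t c k * A j k =
      (A.submatrix (Fin.cons j s : Fin (r + 1) → Fin M)
        (Fin.cons c t : Fin (r + 1) → Fin n)).det := by
  rw [Matrix.det_succ_row_zero]
  simp only [cofactorCoeff, Finset.sum_mul]
  rw [Finset.sum_comm]
  refine Finset.sum_congr rfl fun i _ => ?_
  rw [Finset.sum_eq_single ((Fin.cons c t : Fin (r + 1) → Fin n) i)]
  · rw [if_pos rfl, Matrix.submatrix_submatrix, Matrix.submatrix_apply, Fin.cons_zero,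
      mul_right_comm]
    rfl
  · intro k _ hk
    rw [if_neg hk.symm, zero_mul, zero_mul]
  · simp

theorem cofactorCoeff_self {M n r : ℕ} (A : Matrix (Fin M) (Fin n) ℝ) (s : Fin r → Fin M)
    (t : Fin r → Fin n) {c : Fin n} (hc : ∀ l, t l ≠ c) :
    cofactorCoeff A s t c c = (A.submatrix s t).det := by
  rw [cofactorCoeff, Fin.sum_univ_succ]
  simp [hc]

theorem MeasEssBdd.cofactorCoeff {X : Type*} [MeasurableSpace X] {μ : Measure X} {M n r : ℕ}
    {A : X → Matrix (Fin M) (Fin n) ℝ} (hA : ∀ j k, MeasEssBdd μ (fun x => A x j k))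
    (s : Fin r → Fin M) (t : Fin r → Fin n) (c k : Fin n) :
    MeasEssBdd μ (fun x => cofactorCoeff (A x) s t c k) :=
  MeasEssBdd.sum _ fun _ => (MeasEssBdd.const _).mul (MeasEssBdd.det fun _ _ => hA _ _)

/-- If a matrix of essentially bounded functions has no nontrivial essentially bounded kernel
vector, then it has minors of every order `r ≤ n` that do not vanish almost everywhere. -/
theorem exists_minor_not_ae_zero {X : Type*} [MeasurableSpace X] {μ : Measure X} (hμ : μ ≠ 0)
    {M n : ℕ} {A : X → Matrix (Fin M) (Fin n) ℝ}
    (hA : ∀ j k, MeasEssBdd μ (fun x => A x j k))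
    (hker : ∀ lam : Fin n → X → ℝ, (∀ k, MeasEssBdd μ (lam k)) →
      (∀ j, ∀ᵐ x ∂μ, ∑ k, lam k x * A x j k = 0) → ∀ k, ∀ᵐ x ∂μ, lam k x = 0)
    {r : ℕ} (hr : r ≤ n) :
    ∃ (s : Fin r → Fin M) (t : Fin r → Fin n),
      ¬ ∀ᵐ x ∂μ, ((A x).submatrix s t).det = 0 := by
  induction r with
  | zero =>
    refine ⟨Fin.elim0, Fin.elim0, fun h => hμ ?_⟩
    simpa using h
  | succ r ih =>
    obtain ⟨s, t, hst⟩ := ih (by lia)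
    by_contra! hall
    obtain ⟨c, hc⟩ : ∃ c, ∀ l, t l ≠ c := by
      by_contra! hsurj
      have := Fintype.card_le_of_surjective t hsurj
      simp only [Fintype.card_fin] at this
      lia
    refine hst ?_
    have hzero := hker (fun k x => cofactorCoeff (A x) s t c k)
      (MeasEssBdd.cofactorCoeff hA s t c)
      (fun j => by simpa only [sum_cofactorCoeff_mul] using hall (Fin.cons j s) (Fin.cons c t)) c
    simpa only [cofactorCoeff_self _ s t hc] using hzero

theorem Matrix.det_submatrix_id_ne_zero {M n : ℕ} (A : Matrix (Fin M) (Fin n) ℝ)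
    (s : Fin n → Fin M) (t : Fin n → Fin n) (h : (A.submatrix s t).det ≠ 0) :
    (A.submatrix s id).det ≠ 0 := by
  have hmul : A.submatrix s t
      = A.submatrix s id * (1 : Matrix (Fin n) (Fin n) ℝ).submatrix id t := by
    ext i j
    simp [Matrix.mul_apply, Matrix.one_apply]
  rw [hmul, Matrix.det_mul] at h
  exact left_ne_zero_of_mul h

theorem exists_measure_one_div_le_abs_pos {X : Type*} [MeasurableSpace X] {μ : Measure X}
    {f : X → ℝ} (h : ¬ ∀ᵐ x ∂μ, f x = 0) :
    ∃ m : ℕ, 0 < μ {x | 1 / ((m : ℝ) + 1) ≤ |f x|} := by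
  by_contra! hall
  refine h ?_
  have hae : ∀ m : ℕ, ∀ᵐ x ∂μ, ¬ 1 / ((m : ℝ) + 1) ≤ |f x| := fun m => by
    rw [ae_iff]
    simpa using hall m
  filter_upwards [ae_all_iff.2 hae] with x hx
  by_contra hne
  obtain ⟨m, hm⟩ := exists_nat_one_div_lt (abs_pos.2 hne)
  exact hx m hm.le

theorem stmt_13 {X : Type*} [MetricSpace X] [MeasurableSpace X] [BorelSpace X]
    (μ : Measure X) [SigmaFinite μ] (hμ : μ ≠ 0)
    {n M : ℕ} (Ds : Fin n → MDerivation X μ) (hind : LinIndepDer μ Ds)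
    (g : Fin M → X → ℝ) (hg : ∀ j, IsBddLipschitz (g j))
    (hgen : SeqGenerates (Set.range g)) :
    ∃ σ : Fin n → Fin M, Function.Injective σ ∧
    ∃ V : Set X, MeasurableSet V ∧ 0 < μ V ∧
    ∃ a : Fin n → Fin n → X → ℝ,
      (∀ i j, Measurable (a i j)) ∧
      (∀ i j, ∃ B : ℝ, ∀ᵐ x ∂μ.restrict V, |a i j x| ≤ B) ∧
      (∀ᵐ x ∂μ.restrict V, IsUnit (Matrix.of fun i j => a i j x).det) ∧
      ∀ i j, ∀ᵐ x ∂μ.restrict V,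
        (∑ k, a i k x * (Ds k).D (g (σ j)) x) = if i = j then 1 else 0 := by

  let A : X → Matrix (Fin M) (Fin n) ℝ := fun x => Matrix.of fun j k => (Ds k).D (g j) x
  have hA : ∀ j k, MeasEssBdd μ (fun x => A x j k) := fun j k => (Ds k).measEssBdd (hg j)
  have hker : ∀ lam : Fin n → X → ℝ, (∀ k, MeasEssBdd μ (lam k)) →
      (∀ j, ∀ᵐ x ∂μ, ∑ k, lam k x * A x j k = 0) → ∀ k, ∀ᵐ x ∂μ, lam k x = 0 :=
    fun lam hlam h0 => hind lam (fun k => (hlam k).1) (fun k => (hlam k).2) fun f hf =>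
      MDerivation.sum_mul_D_eq_zero_of_seqGenerates Ds hlam (forall_mem_range.2 hg) hgen
        (forall_mem_range.2 h0) hf
  obtain ⟨σ, t, hσt⟩ := exists_minor_not_ae_zero hμ hA hker le_rfl
  let B : X → Matrix (Fin n) (Fin n) ℝ := fun x => ((A x).submatrix σ id).transpose
  have hB : ∀ k j, MeasEssBdd μ (fun x => B x k j) := fun k j => hA (σ j) k
  have hdet : ¬ ∀ᵐ x ∂μ, (B x).det = 0 := fun h => hσt <| by
    filter_upwards [h] with x hx
    by_contra hne
    exact (A x).det_submatrix_id_ne_zero σ t hne ((Matrix.det_transpose _).symm.trans hx)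
  have hinj : Function.Injective σ := by
    intro i j hij
    by_contra hne
    exact hdet (ae_of_all _ fun x => Matrix.det_zero_of_column_eq hne fun k =>
      congrArg (fun l => A x l k) hij)
  obtain ⟨m, hm⟩ := exists_measure_one_div_le_abs_pos hdet
  have hdetm : Measurable fun x => (B x).det := (MeasEssBdd.det hB).1
  have hV : MeasurableSet {x | 1 / ((m : ℝ) + 1) ≤ |(B x).det|} :=
    measurableSet_le measurable_const hdetm.abs
  have hmpos : (0 : ℝ) < 1 / ((m : ℝ) + 1) := by positivity
  have hunit : ∀ᵐ x ∂μ.restrict {x | 1 / ((m : ℝ) + 1) ≤ |(B x).det|}, IsUnit (B x).det := by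
    filter_upwards [ae_restrict_mem hV] with x hx
    exact isUnit_iff_ne_zero.2 (abs_pos.1 (hmpos.trans_le hx))
  have hinv : ∀ x i j, (B x)⁻¹ i j = (B x).det⁻¹ * (B x).adjugate i j := fun x i j => by
    simp [Matrix.inv_def]
  refine ⟨σ, hinj, _, hV, hm, fun i j x => (B x)⁻¹ i j, fun i j => ?_, fun i j => ?_, ?_,
    fun i j => ?_⟩
  · simp only [hinv]
    exact hdetm.inv.mul (MeasEssBdd.adjugate hB i j).1
  · obtain ⟨-, C, hC⟩ := MeasEssBdd.adjugate hB i j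
    refine ⟨((m : ℝ) + 1) * C, ?_⟩
    filter_upwards [ae_restrict_mem hV, ae_restrict_of_ae hC] with x hx hCx
    rw [hinv, abs_mul, abs_inv]
    refine mul_le_mul ?_ hCx (abs_nonneg _) (by positivity)
    simpa using inv_anti₀ hmpos hx
  · filter_upwards [hunit] with x hx
    exact Matrix.isUnit_nonsing_inv_det (B x) hx
  · filter_upwards [hunit] with x hx
    have h := congrFun (congrFun (Matrix.nonsing_inv_mul (B x) hx) i) j
    rwa [Matrix.mul_apply, Matrix.one_apply] at h
end
end
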